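/- There exists a subgroup G ≤ W isomorphic to the symmetric group S₅ such that: the action of G on the 56 exceptional classes has exactly four orbits, of lengths 2, 12, 12, 30, with point stabilizers isomorphic to the alternating group A₅, the dihedral group of order 10, the dihedral group of order 10, and the Klein four-group C₂ × C₂ respectively; G is minimal; G fixes a conic class; and G satisfies condition (H1). -/

import Mathlib

open scoped BigOperators

noncomputable section

/-- The Picard lattice of a degree 2 del Pezzo surface. -/
abbrev V : Type := Fin 8 → ℤ

/-- The intersection form. -/
def bil (x y : V) : ℤ := x 0 * y 0 - ∑ i ∈ Finset.Ioi (0 : Fin 8), x i * y i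

/-- The canonical class. -/
def Kvec : V := fun i => if i = 0 then -3 else 1

abbrev LatAut := V ≃ₗ[ℤ] V

/-- The Weyl group: automorphisms preserving the form and fixing K. -/
def W : Subgroup LatAut where
  carrier := {g | (∀ x y, bil (g x) (g y) = bil x y) ∧ g Kvec = Kvec}
  one_mem' := ⟨fun _ _ => rfl, rfl⟩
  mul_mem' := by
    rintro a b ⟨ha1, ha2⟩ ⟨hb1, hb2⟩
    refine ⟨fun x y => ?_, ?_⟩
    · show bil (a (b x)) (a (b y)) = bil x y
      rw [ha1, hb1]
    · show a (b Kvec) = Kvec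
      rw [hb2, ha2]
  inv_mem' := by
    rintro a ⟨ha1, ha2⟩
    refine ⟨fun x y => ?_, ?_⟩
    · have h := ha1 (a⁻¹ x) (a⁻¹ y)
      have hx : a (a⁻¹ x) = x := a.apply_symm_apply x
      have hy : a (a⁻¹ y) = y := a.apply_symm_apply y
      rw [hx, hy] at h
      exact h.symm
    · have h2 : a.symm (a Kvec) = a.symm Kvec := by rw [ha2]
      rw [a.symm_apply_apply] at h2
      exact (show a⁻¹ Kvec = a.symm Kvec from rfl).trans h2.symm

/-- Exceptional classes. -/
def Exc : Set V := {E | bil E E = -1 ∧ bil E Kvec = -1}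

/-- Conic classes. -/
def IsConic (C : V) : Prop := bil C C = 0 ∧ bil C Kvec = -2

/-- The orbit of a vector under a subgroup of `LatAut`. -/
def orb (G : Subgroup LatAut) (E : V) : Set V := {v | ∃ g ∈ G, g E = v}

/-- The set of orbits of exceptional classes. -/
def orbs (G : Subgroup LatAut) : Set (Set V) := {S | ∃ E ∈ Exc, S = orb G E}

/-- The stabilizer of a vector, as a subgroup of `LatAut`. -/
def stab (G : Subgroup LatAut) (E : V) : Subgroup LatAut where
  carrier := {g | g ∈ G ∧ g E = E}
  one_mem' := ⟨G.one_mem, rfl⟩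
  mul_mem' := by
    rintro a b ⟨haG, ha⟩ ⟨hbG, hb⟩
    exact ⟨G.mul_mem haG hbG, by show a (b E) = E; rw [hb, ha]⟩
  inv_mem' := by
    rintro a ⟨haG, ha⟩
    refine ⟨G.inv_mem haG, ?_⟩
    conv_lhs => rw [← ha]
    exact a.symm_apply_apply E

/-- `G` is minimal: no nonempty orbit of exceptional classes consists of pairwise
orthogonal classes. -/
def MinimalAction (G : Subgroup LatAut) : Prop :=
  ∀ E ∈ Exc, ¬ (∀ E₁ ∈ orb G E, ∀ E₂ ∈ orb G E, E₁ ≠ E₂ → bil E₁ E₂ = 0)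

/-- The natural representation of a subgroup of `LatAut` on the lattice. -/
def rep (G : Subgroup LatAut) : Representation ℤ G V where
  toFun g := (g : LatAut).toLinearMap
  map_one' := rfl
  map_mul' _ _ := rfl

/-- Condition (H1): the first group cohomology of every subgroup of `G`
with coefficients in the lattice vanishes. -/
def CondH1 (G : Subgroup LatAut) : Prop :=
  ∀ G' : Subgroup LatAut, G' ≤ G →
    Subsingleton (groupCohomology.H1 (Rep.of (rep G')))

open Equiv

/-! ### The intersection form -/

theorem bil_eq (x y : V) : bil x y = x 0 * y 0 - (x 1 * y 1 + x 2 * y 2 + x 3 * y 3 + x 4 * y 4 +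
    x 5 * y 5 + x 6 * y 6 + x 7 * y 7) := by
  have h : Finset.Ioi (0 : Fin 8) = {1, 2, 3, 4, 5, 6, 7} := by decide
  rw [bil, h]
  simp [Finset.sum_insert, add_assoc]

theorem bil_add_right (x y z : V) : bil x (y + z) = bil x y + bil x z := by
  simp only [bil_eq, Pi.add_apply]; ring

theorem bil_smul_right (c : ℤ) (x y : V) : bil x (c • y) = c * bil x y := by
  simp only [bil_eq, Pi.smul_apply, smul_eq_mul]; ring

/-- Pairing with a fixed vector, as a linear form. -/
def bilLeft (x : V) : V →ₗ[ℤ] ℤ where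
  toFun := bil x
  map_add' := bil_add_right x
  map_smul' c y := bil_smul_right c x y

/-! ### A criterion for the vanishing of the first cohomology -/

/-- If the identity of the lattice factors through a permutation module, given by a finite
invariant set of pairs (functional, vector), then the first cohomology vanishes. -/
theorem subsingleton_H1_of_factorization (G : Subgroup LatAut) [Finite G] (hG : G ≤ W)
    (S : Finset (V × V)) (hS : ∀ g ∈ G, S.image (Prod.map g g) = S)
    (hid : ∀ x, ∑ p ∈ S, bil p.1 x • p.2 = x) :
    Subsingleton (groupCohomology.H1 (Rep.of (rep G))) := by
  have := Fintype.ofFinite G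
  refine subsingleton_of_forall_eq 0 fun z => ?_
  induction z using groupCohomology.H1_induction_on with
  | h c =>
  rw [groupCohomology.H1π_eq_zero_iff]
  have hc : ∀ g h : G, c (g * h) = (g : LatAut) (c h) + c g :=
    (groupCohomology.mem_cocycles₁_iff _).1 c.2
  set N : ℤ := (Fintype.card G : ℤ) with hN
  have hN0 : N ≠ 0 := by simp [hN]
  let A : V → ℤ := fun y => ∑ h : G, bil y (c h)
  have hA : ∀ (g : G) (y : V), A ((g : LatAut) y) = A y + N * bil ((g : LatAut) y) (c g) := by
    intro g y
    calc A ((g : LatAut) y) = ∑ h : G, bil ((g : LatAut) y) (c (g * h)) :=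
          (Equiv.sum_comp (Equiv.mulLeft g) fun h => bil ((g : LatAut) y) (c h)).symm
      _ = ∑ h : G, (bil y (c h) + bil ((g : LatAut) y) (c g)) := by
          refine Finset.sum_congr rfl fun h _ => ?_
          rw [hc, bil_add_right, (hG g.2).1]
      _ = _ := by simp [Finset.sum_add_distrib, A, hN]
  have hdiv : ∀ (g : G) (y : V),
      bil ((g : LatAut) y) (c g) = A ((g : LatAut) y) / N - A y / N := by
    intro g y
    rw [hA, Int.add_mul_ediv_left _ _ hN0]
    ring
  let m : V := ∑ p ∈ S, (A p.1 / N) • p.2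
  have hsum : ∀ (g : G) (F : V × V → V),
      ∑ p ∈ S, F p = ∑ p ∈ S, F ((g : LatAut) p.1, (g : LatAut) p.2) := by
    intro g F
    conv_lhs => rw [← hS g g.2]
    rw [Finset.sum_image]
    · rfl
    · exact ((g : LatAut).injective.prodMap (g : LatAut).injective).injOn
  refine ⟨-m, funext fun g => ?_⟩
  have hcg : c g = m - (g : LatAut) m := by
    calc c g = ∑ p ∈ S, bil p.1 (c g) • p.2 := (hid _).symm
      _ = ∑ p ∈ S, bil ((g : LatAut) p.1) (c g) • (g : LatAut) p.2 :=
          hsum g fun p => bil p.1 (c g) • p.2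
      _ = ∑ p ∈ S, (A ((g : LatAut) p.1) / N) • (g : LatAut) p.2 -
            ∑ p ∈ S, (A p.1 / N) • (g : LatAut) p.2 := by
          rw [← Finset.sum_sub_distrib]
          exact Finset.sum_congr rfl fun p _ => by rw [hdiv, sub_smul]
      _ = m - (g : LatAut) m := by
          rw [← hsum g fun p => (A p.1 / N) • p.2]
          simp only [m, map_sum, map_smul]
  rw [hcg]
  change (g : LatAut) (-m) - -m = _
  rw [map_neg]
  abel

/-! ### The exotic action of `S₅` -/

/-- The nontrivial powers of a permutation of order five. -/
def powers (c : Perm (Fin 5)) : Finset (Perm (Fin 5)) := {c, c ^ 2, c ^ 3, c ^ 4}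

/-- The six Sylow `5`-subgroups of `S₅` without the identity, in positions `1, …, 6`, flanked by
two sets that are stable under conjugation. -/
def conjSet : Fin 8 → Finset (Perm (Fin 5)) :=
  ![∅, powers c[0, 1, 2, 3, 4], powers c[0, 1, 2, 4, 3], powers c[0, 1, 3, 2, 4],
    powers c[0, 1, 3, 4, 2], powers c[0, 1, 4, 2, 3], powers c[0, 1, 4, 3, 2], {1}]

theorem conjSet_injective : Function.Injective conjSet := by decide +kernel

/-- Conjugation by `g` carries the `i`-th set to the `j`-th one. -/
def Conjugates (g : Perm (Fin 5)) (i j : Fin 8) : Prop :=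
  (conjSet i).image (fun x => g * x * g⁻¹) = conjSet j

instance (g : Perm (Fin 5)) (i j : Fin 8) : Decidable (Conjugates g i j) :=
  inferInstanceAs (Decidable (_ = _))

theorem Conjugates.one (i : Fin 8) : Conjugates 1 i i := by simp [Conjugates]

theorem Conjugates.mul {g h : Perm (Fin 5)} {i j k : Fin 8} (hg : Conjugates g j k)
    (hh : Conjugates h i j) : Conjugates (g * h) i k := by
  rw [Conjugates, ← hg, ← hh, Finset.image_image]
  simp [Function.comp_def, mul_assoc]

theorem Conjugates.inv {g : Perm (Fin 5)} {i j : Fin 8} (hg : Conjugates g i j) :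
    Conjugates g⁻¹ j i := by
  rw [Conjugates, ← hg, Finset.image_image]
  simp [Function.comp_def, mul_assoc]

theorem Conjugates.unique {g : Perm (Fin 5)} {i j k : Fin 8} (hj : Conjugates g i j)
    (hk : Conjugates g i k) : j = k :=
  conjSet_injective (hj.symm.trans hk)

/-- A `5`-cycle which, with a transposition, generates `S₅`. -/
abbrev rot : Perm (Fin 5) := c[0, 1, 2, 3, 4]

/-- A transposition which, with a `5`-cycle, generates `S₅`. -/
abbrev transp : Perm (Fin 5) := swap 0 1

/-- The conjugation action of `rot` on the six Sylow subgroups. -/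
abbrev rotConj : Perm (Fin 8) := c[2, 4, 6, 5, 3]

/-- The conjugation action of `transp` on the six Sylow subgroups. -/
abbrev transpConj : Perm (Fin 8) := swap 1 6 * swap 2 4 * swap 3 5

theorem conjugates_rot : ∀ i, Conjugates rot i (rotConj i) := by decide +kernel

theorem conjugates_transp : ∀ i, Conjugates transp i (transpConj i) := by decide +kernel

theorem closure_rot_transp : Subgroup.closure {rot, transp} = ⊤ := by
  have h : transp = swap 0 (rot 0) := by decide +kernel
  rw [h]
  refine Perm.closure_cycle_adjacent_swap ?_ (by decide +kernel) 0
  exact ⟨0, by decide +kernel, by decide +kernel⟩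

theorem generator_induction {P : Perm (Fin 5) → Prop} (hr : P rot) (ht : P transp) (h1 : P 1)
    (hm : ∀ g h, P g → P h → P (g * h)) (hi : ∀ g, P g → P g⁻¹) (g : Perm (Fin 5)) : P g := by
  have hg : g ∈ Subgroup.closure {rot, transp} := closure_rot_transp ▸ Subgroup.mem_top g
  induction hg using Subgroup.closure_induction with
  | mem x hx => rcases hx with rfl | rfl <;> assumption
  | one => exact h1
  | mul x y _ _ hx hy => exact hm x y hx hy
  | inv x _ hx => exact hi x hx

theorem exists_conjugates (g : Perm (Fin 5)) : ∃ σ : Perm (Fin 8), ∀ i, Conjugates g i (σ i) := by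
  induction g using generator_induction with
  | hr => exact ⟨_, conjugates_rot⟩
  | ht => exact ⟨_, conjugates_transp⟩
  | h1 => exact ⟨1, Conjugates.one⟩
  | hm g h hg hh =>
    obtain ⟨σ, hσ⟩ := hg
    obtain ⟨τ, hτ⟩ := hh
    exact ⟨σ * τ, fun i => (hσ _).mul (hτ i)⟩
  | hi g hg =>
    obtain ⟨σ, hσ⟩ := hg
    exact ⟨σ⁻¹, fun i => by simpa using (hσ (σ⁻¹ i)).inv⟩

/-- The conjugation action of `S₅` on its six Sylow `5`-subgroups. -/
def sylowHom : Perm (Fin 5) →* Perm (Fin 8) where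
  toFun g := (exists_conjugates g).choose
  map_one' := Equiv.ext fun i => ((exists_conjugates 1).choose_spec i).unique (Conjugates.one i)
  map_mul' g h := Equiv.ext fun i => ((exists_conjugates (g * h)).choose_spec i).unique
    (((exists_conjugates g).choose_spec _).mul ((exists_conjugates h).choose_spec i))

theorem sylowHom_apply_eq_iff {g : Perm (Fin 5)} {i j : Fin 8} :
    sylowHom g i = j ↔ Conjugates g i j :=
  ⟨fun h => h ▸ (exists_conjugates g).choose_spec i,
    fun h => ((exists_conjugates g).choose_spec i).unique h⟩

theorem sylowHom_rot : sylowHom rot = rotConj :=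
  Equiv.ext fun i => sylowHom_apply_eq_iff.2 (conjugates_rot i)

theorem sylowHom_transp : sylowHom transp = transpConj :=
  Equiv.ext fun i => sylowHom_apply_eq_iff.2 (conjugates_transp i)

theorem sylowHom_zero (g : Perm (Fin 5)) : sylowHom g 0 = 0 :=
  sylowHom_apply_eq_iff.2 rfl

theorem sylowHom_seven (g : Perm (Fin 5)) : sylowHom g 7 = 7 :=
  sylowHom_apply_eq_iff.2 (by simp [Conjugates, conjSet])

theorem sylowHom_injective : Function.Injective sylowHom := by
  have h : ∀ g, Conjugates g 1 1 → Conjugates g 2 2 → Conjugates g 3 3 → g = 1 := by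
    decide +kernel
  refine (injective_iff_map_eq_one _).2 fun g hg => ?_
  have hfix : ∀ i, Conjugates g i i := fun i => sylowHom_apply_eq_iff.1 (by rw [hg]; rfl)
  exact h g (hfix 1) (hfix 2) (hfix 3)

/-- `S₅` moves two distinct Sylow subgroups to any two others, with a prescribed sign. -/
theorem exists_sylowHom_pair (i j : Fin 8) (hi : i ≠ 0 ∧ i ≠ 7) (hj : j ≠ 0 ∧ j ≠ 7) (hij : i ≠ j)
    (s : ℤˣ) : ∃ g, sylowHom g 1 = i ∧ sylowHom g 2 = j ∧ Perm.sign g = s := by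
  have h : ∀ i j : Fin 8, i ≠ 0 ∧ i ≠ 7 → j ≠ 0 ∧ j ≠ 7 → i ≠ j → ∀ s : ℤˣ,
      ∃ k l m : Fin 5, ∃ a b c : Fin 2,
      rotConj^[k] (transpConj^[a] (rotConj^[l] (transpConj^[b] (rotConj^[m]
        (transpConj^[c] 1))))) = i ∧
      rotConj^[k] (transpConj^[a] (rotConj^[l] (transpConj^[b] (rotConj^[m]
        (transpConj^[c] 2))))) = j ∧ (-1 : ℤˣ) ^ (a + b + c : ℕ) = s := by decide +kernel
  obtain ⟨k, l, m, a, b, c, h1, h2, h3⟩ := h i j hi hj hij s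
  refine ⟨rot ^ (k : ℕ) * transp ^ (a : ℕ) * rot ^ (l : ℕ) * transp ^ (b : ℕ) * rot ^ (m : ℕ) *
    transp ^ (c : ℕ), ?_, ?_, ?_⟩
  · simpa only [map_mul, map_pow, sylowHom_rot, sylowHom_transp, Perm.mul_apply,
      ← Perm.iterate_eq_pow] using h1
  · simpa only [map_mul, map_pow, sylowHom_rot, sylowHom_transp, Perm.mul_apply,
      ← Perm.iterate_eq_pow] using h2
  · have hr : Perm.sign rot = 1 := by decide +kernel
    have ht : Perm.sign transp = -1 := by decide +kernel
    simpa only [map_mul, map_pow, hr, ht, one_pow, one_mul, mul_one, ← pow_add] using h3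

/-! ### The lattice automorphisms -/

/-- The conic class fixed by the action. -/
def Cvec : V := ![1, 0, 0, 0, 0, 0, 0, -1]

/-- The class of a line. -/
def lineClass : V := Pi.single 0 1

/-- The `i`-th exceptional divisor of the blow-up of the plane, for `i ≠ 0`. -/
def excDiv (i : Fin 8) : V := Pi.single i 1

/-- Permutations act on the lattice by permuting coordinates. -/
def permAut : Perm (Fin 8) →* LatAut where
  toFun σ := LinearEquiv.funCongrLeft ℤ ℤ σ⁻¹
  map_one' := rfl
  map_mul' _ _ := rfl

theorem permAut_apply (σ : Perm (Fin 8)) (x : V) (i : Fin 8) : permAut σ x i = x (σ⁻¹ i) := rfl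

theorem permAut_single (σ : Perm (Fin 8)) (i : Fin 8) :
    permAut σ (Pi.single i 1) = Pi.single (σ i) 1 := by
  funext j
  simp only [permAut_apply, Pi.single_apply, Perm.inv_eq_iff_eq]

theorem bil_permAut {σ : Perm (Fin 8)} (h0 : σ 0 = 0) (x y : V) :
    bil (permAut σ x) (permAut σ y) = bil x y := by
  have key : ∀ x y : V, bil x y = 2 * (x 0 * y 0) - ∑ i, x i * y i := by
    intro x y
    rw [bil_eq, Fin.sum_univ_eight]
    ring
  have h0' : σ⁻¹ 0 = 0 := by rw [Perm.inv_eq_iff_eq, h0]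
  rw [key, key]
  simp only [permAut_apply, h0']
  rw [Equiv.sum_comp σ⁻¹ fun i => x i * y i]

theorem permAut_Kvec {σ : Perm (Fin 8)} (h0 : σ 0 = 0) : permAut σ Kvec = Kvec := by
  funext j
  simp only [permAut_apply, Kvec, Perm.inv_eq_iff_eq, h0]

theorem permAut_Cvec {σ : Perm (Fin 8)} (h0 : σ 0 = 0) (h7 : σ 7 = 7) :
    permAut σ Cvec = Cvec := by
  have h : Cvec = Pi.single 0 1 - Pi.single 7 1 := by decide
  rw [h, map_sub, permAut_single, permAut_single, h0, h7]

/-- The involution fixing the canonical and the conic class and acting by `-1` on their orthogonal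
complement. It exchanges the two components of each of the six singular conics. -/
def flipMap (x : V) : V := -x - (bil x Kvec + bil x Cvec) • Cvec - bil x Cvec • Kvec

theorem bil_Kvec (x : V) :
    bil x Kvec = -3 * x 0 - (x 1 + x 2 + x 3 + x 4 + x 5 + x 6 + x 7) := by
  rw [bil_eq]
  simp only [Kvec, Fin.isValue, ↓reduceIte, one_ne_zero, Fin.reduceEq]
  ring

theorem bil_Cvec (x : V) : bil x Cvec = x 0 + x 7 := by
  rw [bil_eq]
  simp [Cvec]

theorem flipMap_eq (x : V) : flipMap x =
    ![4 * x 0 + (x 1 + x 2 + x 3 + x 4 + x 5 + x 6) + 3 * x 7, -(x 0 + x 7) - x 1,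
      -(x 0 + x 7) - x 2, -(x 0 + x 7) - x 3, -(x 0 + x 7) - x 4, -(x 0 + x 7) - x 5,
      -(x 0 + x 7) - x 6, -3 * x 0 - (x 1 + x 2 + x 3 + x 4 + x 5 + x 6) - 2 * x 7] := by
  funext i
  simp only [flipMap, bil_Kvec, bil_Cvec, Pi.sub_apply, Pi.neg_apply, Pi.smul_apply, smul_eq_mul]
  fin_cases i <;> simp [Cvec, Kvec] <;> ring

theorem flipMap_flipMap (x : V) : flipMap (flipMap x) = x := by
  rw [flipMap_eq, flipMap_eq]
  funext i
  fin_cases i <;> simp <;> ring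

/-- The linear automorphism underlying `flipMap`. -/
def flipAut : LatAut where
  toFun := flipMap
  invFun := flipMap
  map_add' x y := by
    rw [flipMap_eq, flipMap_eq, flipMap_eq]
    funext i
    fin_cases i <;> simp <;> ring
  map_smul' c x := by
    rw [flipMap_eq, flipMap_eq]
    funext i
    fin_cases i <;> simp <;> ring
  left_inv := flipMap_flipMap
  right_inv := flipMap_flipMap

theorem flipAut_apply (x : V) : flipAut x = flipMap x := rfl

theorem flipAut_mem_W : flipAut ∈ W := by
  refine ⟨fun x y => ?_, by decide +kernel⟩
  simp only [flipAut_apply, flipMap_eq, bil_eq]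
  simp
  ring

theorem flipAut_Cvec : flipAut Cvec = Cvec := by decide +kernel

theorem commute_permAut_flipAut {σ : Perm (Fin 8)} (h0 : σ 0 = 0) (h7 : σ 7 = 7) :
    Commute (permAut σ) flipAut := by
  refine LinearEquiv.ext fun x => ?_
  have hK : bil (permAut σ x) Kvec = bil x Kvec := by
    conv_lhs => rw [← permAut_Kvec h0, bil_permAut h0]
  have hC : bil (permAut σ x) Cvec = bil x Cvec := by
    conv_lhs => rw [← permAut_Cvec h0 h7, bil_permAut h0]
  simp only [LinearEquiv.mul_apply, flipAut_apply, flipMap, hK, hC, map_sub, map_neg, map_smul,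
    permAut_Kvec h0, permAut_Cvec h0 h7]

/-- The action of signs on the lattice through the involution `flipAut`. -/
def signAut : ℤˣ →* LatAut where
  toFun s := if s = 1 then 1 else flipAut
  map_one' := rfl
  map_mul' s t := by
    have h : flipAut * flipAut = 1 := LinearEquiv.ext flipMap_flipMap
    rcases Int.units_eq_one_or s with rfl | rfl <;> rcases Int.units_eq_one_or t with rfl | rfl <;>
      simp [h]

theorem signAut_mem_W (s : ℤˣ) : signAut s ∈ W := by
  rcases Int.units_eq_one_or s with rfl | rfl
  · simp [one_mem]
  · exact flipAut_mem_W

theorem signAut_Cvec (s : ℤˣ) : signAut s Cvec = Cvec := by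
  rcases Int.units_eq_one_or s with rfl | rfl
  · simp
  · exact flipAut_Cvec

theorem commute_permAut_signAut {σ : Perm (Fin 8)} (h0 : σ 0 = 0) (h7 : σ 7 = 7) (s : ℤˣ) :
    Commute (permAut σ) (signAut s) := by
  rcases Int.units_eq_one_or s with rfl | rfl
  · simp
  · exact commute_permAut_flipAut h0 h7

/-- The action of `S₅` on the lattice: the exotic permutation of the six blown-up points, composed
with the flip for odd permutations. -/
def latHom : Perm (Fin 5) →* LatAut where
  toFun g := permAut (sylowHom g) * signAut (Perm.sign g)
  map_one' := by simp
  map_mul' g h := by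
    simp only [map_mul]
    have := commute_permAut_signAut (sylowHom_zero h) (sylowHom_seven h) (Perm.sign g)
    rw [mul_assoc, mul_assoc, ← mul_assoc (permAut (sylowHom h)), this.eq, mul_assoc]

theorem latHom_def (g : Perm (Fin 5)) :
    latHom g = permAut (sylowHom g) * signAut (Perm.sign g) := rfl

theorem latHom_mem_W (g : Perm (Fin 5)) : latHom g ∈ W :=
  mul_mem ⟨bil_permAut (sylowHom_zero g), permAut_Kvec (sylowHom_zero g)⟩ (signAut_mem_W _)

theorem latHom_Kvec (g : Perm (Fin 5)) : latHom g Kvec = Kvec := (latHom_mem_W g).2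

theorem latHom_Cvec (g : Perm (Fin 5)) : latHom g Cvec = Cvec := by
  rw [latHom_def, LinearEquiv.mul_apply, signAut_Cvec,
    permAut_Cvec (sylowHom_zero g) (sylowHom_seven g)]

/-- The image of `S₅` in the Weyl group. -/
def quinticGroup : Subgroup LatAut := latHom.range

theorem quinticGroup_le_W : quinticGroup ≤ W := by
  rintro _ ⟨g, rfl⟩
  exact latHom_mem_W g

instance : Finite quinticGroup := Finite.of_surjective _ latHom.rangeRestrict_surjective

theorem latHom_signAut (g : Perm (Fin 5)) (s : ℤˣ) (x : V) :
    latHom g (signAut s x) = signAut (Perm.sign g * s) (permAut (sylowHom g) x) := by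
  rw [← LinearEquiv.mul_apply (latHom g), latHom_def, mul_assoc, ← map_mul,
    (commute_permAut_signAut (sylowHom_zero g) (sylowHom_seven g) _).eq, LinearEquiv.mul_apply]

theorem latHom_apply (g : Perm (Fin 5)) (x : V) :
    latHom g x = signAut (Perm.sign g) (permAut (sylowHom g) x) := by
  simpa using latHom_signAut g 1 x

/-! ### Exceptional classes and their orbits -/

/-- The indices of the six points permuted by the action. -/
def middle : Finset (Fin 8) := {1, 2, 3, 4, 5, 6}

theorem mem_middle {i : Fin 8} : i ∈ middle ↔ i ≠ 0 ∧ i ≠ 7 := by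
  revert i
  decide

theorem sylowHom_mem_middle (g : Perm (Fin 5)) {i : Fin 8} (hi : i ∈ middle) :
    sylowHom g i ∈ middle := by
  rw [mem_middle] at hi ⊢
  refine ⟨fun h => hi.1 ((sylowHom g).injective ?_), fun h => hi.2 ((sylowHom g).injective ?_)⟩
  · rw [h, sylowHom_zero]
  · rw [h, sylowHom_seven]

/-- The class of the line through the points `i` and `j`. -/
def chord (i j : Fin 8) : V := lineClass - excDiv i - excDiv j

/-- Representatives of the four orbits of exceptional classes. -/
def orbitRep : Fin 4 → V := ![excDiv 7, excDiv 1, -Kvec - excDiv 1, chord 1 2]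

/-- The four orbits of exceptional classes. -/
def orbitFinset : Fin 4 → Finset V :=
  ![Finset.univ.image fun s : ℤˣ => signAut s (excDiv 7),
    (Finset.univ ×ˢ middle).image fun p : ℤˣ × Fin 8 => signAut p.1 (excDiv p.2),
    (Finset.univ ×ˢ middle).image fun p : ℤˣ × Fin 8 => signAut p.1 (-Kvec - excDiv p.2),
    (Finset.univ ×ˢ middle.offDiag).image fun p : ℤˣ × Fin 8 × Fin 8 =>
      signAut p.1 (chord p.2.1 p.2.2)]

/-- The lengths of the four orbits. -/
def orbitLength : Fin 4 → ℕ := ![2, 12, 12, 30]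

theorem card_orbitFinset : ∀ k, (orbitFinset k).card = orbitLength k := by decide +kernel

theorem permAut_excDiv (σ : Perm (Fin 8)) (i : Fin 8) : permAut σ (excDiv i) = excDiv (σ i) :=
  permAut_single σ i

theorem permAut_chord {σ : Perm (Fin 8)} (h0 : σ 0 = 0) (i j : Fin 8) :
    permAut σ (chord i j) = chord (σ i) (σ j) := by
  rw [chord, chord, map_sub, map_sub, permAut_excDiv, permAut_excDiv, lineClass, permAut_single, h0]

theorem mem_orb {x v : V} : v ∈ orb quinticGroup x ↔ ∃ g, latHom g x = v := by
  simp [orb, quinticGroup]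

theorem orb_eq_of_mem {x v : V} (h : v ∈ orb quinticGroup x) :
    orb quinticGroup v = orb quinticGroup x := by
  obtain ⟨g, rfl⟩ := mem_orb.1 h
  ext w
  rw [mem_orb, mem_orb]
  constructor
  · rintro ⟨h, rfl⟩
    exact ⟨h * g, by rw [map_mul, LinearEquiv.mul_apply]⟩
  · rintro ⟨h, rfl⟩
    exact ⟨h * g⁻¹, by rw [← LinearEquiv.mul_apply, ← map_mul, inv_mul_cancel_right]⟩

theorem orb_orbitRep (k : Fin 4) : orb quinticGroup (orbitRep k) = orbitFinset k := by
  have h1 : (1 : Fin 8) ∈ middle := by decide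
  have h2 : (2 : Fin 8) ∈ middle := by decide
  have hex : ∀ i ∈ middle, ∀ s : ℤˣ, ∃ g, sylowHom g 1 = i ∧ Perm.sign g = s := by
    intro i hi s
    obtain ⟨j, hj, hij⟩ : ∃ j ∈ middle, i ≠ j := by
      revert i
      decide
    obtain ⟨g, hg1, -, hs⟩ := exists_sylowHom_pair i j (mem_middle.1 hi) (mem_middle.1 hj) hij s
    exact ⟨g, hg1, hs⟩
  ext v
  rw [mem_orb]
  simp only [latHom_apply]
  fin_cases k
  · simp only [orbitRep, orbitFinset, Fin.zero_eta, Matrix.cons_val_zero, permAut_excDiv,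
      sylowHom_seven, Finset.coe_image, Finset.coe_univ, Set.image_univ, Set.mem_range]
    constructor
    · rintro ⟨g, rfl⟩
      exact ⟨_, rfl⟩
    · rintro ⟨s, rfl⟩
      obtain ⟨g, -, rfl⟩ := hex 1 h1 s
      exact ⟨g, rfl⟩
  · change (∃ g, signAut (Perm.sign g) (permAut (sylowHom g) (excDiv 1)) = v) ↔
      v ∈ Finset.image _ _
    simp only [permAut_excDiv, Finset.mem_image, Finset.mem_product, Finset.mem_univ, true_and,
      Prod.exists]
    constructor
    · rintro ⟨g, rfl⟩
      exact ⟨_, _, sylowHom_mem_middle g h1, rfl⟩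
    · rintro ⟨s, i, hi, rfl⟩
      obtain ⟨g, rfl, rfl⟩ := hex i hi s
      exact ⟨g, rfl⟩
  · change (∃ g, signAut (Perm.sign g) (permAut (sylowHom g) (-Kvec - excDiv 1)) = v) ↔
      v ∈ Finset.image _ _
    simp only [map_sub (permAut _), map_neg (permAut _), permAut_Kvec (sylowHom_zero _),
      permAut_excDiv, Finset.mem_image, Finset.mem_product, Finset.mem_univ, true_and, Prod.exists]
    constructor
    · rintro ⟨g, rfl⟩
      exact ⟨_, _, sylowHom_mem_middle g h1, rfl⟩
    · rintro ⟨s, i, hi, rfl⟩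
      obtain ⟨g, rfl, rfl⟩ := hex i hi s
      exact ⟨g, rfl⟩
  · change (∃ g, signAut (Perm.sign g) (permAut (sylowHom g) (chord 1 2)) = v) ↔
      v ∈ Finset.image _ _
    simp only [permAut_chord (sylowHom_zero _), Finset.mem_image, Finset.mem_product,
      Finset.mem_univ, true_and, Prod.exists, Finset.mem_offDiag]
    constructor
    · rintro ⟨g, rfl⟩
      exact ⟨_, _, _, ⟨sylowHom_mem_middle g h1, sylowHom_mem_middle g h2,
        (sylowHom g).injective.ne (by decide)⟩, rfl⟩
    · rintro ⟨s, i, j, ⟨hi, hj, hij⟩, rfl⟩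
      obtain ⟨g, rfl, rfl, rfl⟩ :=
        exists_sylowHom_pair i j (mem_middle.1 hi) (mem_middle.1 hj) hij s
      exact ⟨g, rfl⟩

theorem ncard_orb_orbitRep (k : Fin 4) :
    (orb quinticGroup (orbitRep k)).ncard = orbitLength k := by
  rw [orb_orbitRep, Set.ncard_coe_finset, card_orbitFinset]

theorem exists_eq_add_toNat_of_sum_eq_zero {m : ℤ} {x : Fin 7 → ℤ}
    (h : ∑ i, (x i - m) * (x i - (m + 1)) = 0) (i : Fin 7) :
    ∃ b : Bool, x i = m + b.toNat := by
  have hnonneg : ∀ j ∈ Finset.univ, 0 ≤ (x j - m) * (x j - (m + 1)) := by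
    intro j _
    rcases le_or_gt (x j) m with hj | hj
    · exact mul_nonneg_of_nonpos_of_nonpos (by lia) (by lia)
    · exact mul_nonneg (by lia) (by lia)
  rcases mul_eq_zero.1 ((Finset.sum_eq_zero_iff_of_nonneg hnonneg).1 h i (Finset.mem_univ i))
    with hi | hi
  · exact ⟨false, by simpa [sub_eq_zero] using hi⟩
  · exact ⟨true, by simpa [sub_eq_zero] using hi⟩

/-- The smaller of the two values taken by the multiplicities of an exceptional class of degree
`d`. -/
def lowMultiplicity : Fin 4 → ℤ := ![0, -1, -1, -2]

theorem exists_mem_orbitFinset {x : V} (hx : x ∈ Exc) : ∃ k, x ∈ orbitFinset k := by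
  have hcheck : ∀ (d : Fin 4) (b₁ b₂ b₃ b₄ b₅ b₆ b₇ : Bool),
      let m := lowMultiplicity d
      let y : V := ![(d : ℕ), m + b₁.toNat, m + b₂.toNat, m + b₃.toNat, m + b₄.toNat, m + b₅.toNat,
        m + b₆.toNat, m + b₇.toNat]
      bil y Kvec = -1 → bil y y = -1 → ∃ k, y ∈ orbitFinset k := by
    decide +kernel
  obtain ⟨h1, h2⟩ := hx
  have hK := h2
  have hsq := h1
  rw [bil_Kvec] at hK
  rw [bil_eq] at hsq
  have hbound : x 0 ^ 2 - 3 * x 0 - 3 ≤ 0 := by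
    nlinarith [sq_nonneg (7 * x 1 + 3 * x 0 - 1), sq_nonneg (7 * x 2 + 3 * x 0 - 1),
      sq_nonneg (7 * x 3 + 3 * x 0 - 1), sq_nonneg (7 * x 4 + 3 * x 0 - 1),
      sq_nonneg (7 * x 5 + 3 * x 0 - 1), sq_nonneg (7 * x 6 + 3 * x 0 - 1),
      sq_nonneg (7 * x 7 + 3 * x 0 - 1)]
  have hlow : 0 ≤ x 0 := by nlinarith
  have hhigh : x 0 ≤ 3 := by nlinarith
  obtain ⟨d, hd⟩ : ∃ d : Fin 4, x 0 = (d : ℕ) :=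
    ⟨⟨(x 0).toNat, by lia⟩, by simp [hlow]⟩
  have hsum : ∑ i : Fin 7, (x i.succ - lowMultiplicity d) *
      (x i.succ - (lowMultiplicity d + 1)) = 0 := by
    simp only [Fin.sum_univ_seven]
    change (x 1 - _) * (x 1 - _) + (x 2 - _) * (x 2 - _) + (x 3 - _) * (x 3 - _) +
      (x 4 - _) * (x 4 - _) + (x 5 - _) * (x 5 - _) + (x 6 - _) * (x 6 - _) +
      (x 7 - _) * (x 7 - _) = 0
    have hm : 7 * lowMultiplicity d * (lowMultiplicity d + 1) + x 0 ^ 2 + 1 =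
        (2 * lowMultiplicity d + 1) * (1 - 3 * x 0) := by
      have h : ∀ d : Fin 4,
          7 * lowMultiplicity d * (lowMultiplicity d + 1) + ((d : ℕ) : ℤ) ^ 2 + 1 =
          (2 * lowMultiplicity d + 1) * (1 - 3 * ((d : ℕ) : ℤ)) := by
        decide
      rw [hd]
      exact h d
    linear_combination hm - hsq + (2 * lowMultiplicity d + 1) * hK
  choose b hb using exists_eq_add_toNat_of_sum_eq_zero hsum
  have hxb : x = (![((d : ℕ) : ℤ), lowMultiplicity d + (b 0).toNat, lowMultiplicity d + (b 1).toNat,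
      lowMultiplicity d + (b 2).toNat, lowMultiplicity d + (b 3).toNat,
      lowMultiplicity d + (b 4).toNat, lowMultiplicity d + (b 5).toNat,
      lowMultiplicity d + (b 6).toNat] : V) := by
    funext i
    refine Fin.cases hd (fun j => ?_) i
    rw [hb j]
    fin_cases j <;> rfl
  rw [hxb] at h1 h2 ⊢
  exact hcheck d _ _ _ _ _ _ _ h2 h1

theorem orbitRep_mem_Exc : ∀ k, orbitRep k ∈ Exc := by
  have h : ∀ k, bil (orbitRep k) (orbitRep k) = -1 ∧ bil (orbitRep k) Kvec = -1 := by
    decide +kernel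
  exact h

theorem exists_mem_orb {x : V} (hx : x ∈ Exc) : ∃ k, x ∈ orb quinticGroup (orbitRep k) := by
  obtain ⟨k, hk⟩ := exists_mem_orbitFinset hx
  exact ⟨k, by rwa [orb_orbitRep]⟩

theorem orbs_quinticGroup :
    orbs quinticGroup = Set.range fun k => orb quinticGroup (orbitRep k) := by
  ext S
  constructor
  · rintro ⟨x, hx, rfl⟩
    obtain ⟨k, hk⟩ := exists_mem_orb hx
    exact ⟨k, (orb_eq_of_mem hk).symm⟩
  · rintro ⟨k, rfl⟩
    exact ⟨_, orbitRep_mem_Exc k, rfl⟩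

theorem orb_orbitRep_injective :
    Function.Injective fun k => orb quinticGroup (orbitRep k) := by
  intro k l (hkl : orb quinticGroup (orbitRep k) = orb quinticGroup (orbitRep l))
  have hsep : ∀ k l, orbitLength k = orbitLength l →
      bil (orbitRep k) Cvec = bil (orbitRep l) Cvec → k = l := by
    decide +kernel
  refine hsep k l (by rw [← ncard_orb_orbitRep, ← ncard_orb_orbitRep, hkl]) ?_
  have hl : orbitRep l ∈ orb quinticGroup (orbitRep k) := by
    rw [hkl]
    exact mem_orb.2 ⟨1, by simp⟩
  obtain ⟨g, hg⟩ := mem_orb.1 hl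
  rw [← hg]
  conv_rhs => rw [← latHom_Cvec g, (latHom_mem_W g).1]

theorem ncard_orbs_of_length (n : ℕ) :
    {S ∈ orbs quinticGroup | S.ncard = n}.ncard =
      (Finset.univ.filter fun k => orbitLength k = n).card := by
  have h : {S ∈ orbs quinticGroup | S.ncard = n} =
      (fun k => orb quinticGroup (orbitRep k)) '' {k | orbitLength k = n} := by
    ext S
    rw [orbs_quinticGroup]
    constructor
    · rintro ⟨⟨k, rfl⟩, hk⟩
      exact ⟨k, (ncard_orb_orbitRep k).symm.trans hk, rfl⟩
    · rintro ⟨k, hk, rfl⟩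
      exact ⟨⟨k, rfl⟩, (ncard_orb_orbitRep k).trans hk⟩
  rw [h, Set.ncard_image_of_injective _ orb_orbitRep_injective, ← Set.ncard_coe_finset]
  simp

theorem minimalAction_quinticGroup : MinimalAction quinticGroup := by
  have hflip : ∀ k, signAut (-1) (orbitRep k) ∈ orbitFinset k ∧
      orbitRep k ≠ signAut (-1) (orbitRep k) ∧
      bil (orbitRep k) (signAut (-1) (orbitRep k)) ≠ 0 := by
    decide +kernel
  intro x hx horth
  obtain ⟨k, hk⟩ := exists_mem_orb hx
  rw [orb_eq_of_mem hk] at horth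
  obtain ⟨hmem, hne, hbil⟩ := hflip k
  refine hbil (horth _ (mem_orb.2 ⟨1, by simp⟩) _ ?_ hne)
  rw [orb_orbitRep]
  exact hmem

/-! ### Stabilizers -/

theorem latHom_injective : Function.Injective latHom := by
  refine (injective_iff_map_eq_one _).2 fun g hg => ?_
  have hsep : ∀ (s : ℤˣ), signAut s (excDiv 7) = excDiv 7 → s = 1 := by decide +kernel
  have hs : Perm.sign g = 1 := by
    refine hsep _ ?_
    have h := latHom_apply g (excDiv 7)
    rw [permAut_excDiv, sylowHom_seven, hg] at h
    exact h.symm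
  refine sylowHom_injective (Equiv.ext fun i => ?_)
  have h := latHom_apply g (excDiv i)
  rw [permAut_excDiv, hg, hs, map_one] at h
  have hexc : ∀ i j, excDiv i = excDiv j → i = j := by decide +kernel
  simpa using (hexc _ _ h).symm

theorem nonempty_stab_mulEquiv {H : Type*} [Group H] (f : H →* Perm (Fin 5))
    (hf : Function.Injective f) {r x : V} (hr : ∀ g, latHom g r = r ↔ g ∈ f.range)
    (hx : x ∈ orb quinticGroup r) :
    Nonempty (stab quinticGroup x ≃* H) := by
  obtain ⟨h, rfl⟩ := mem_orb.1 hx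
  have hmem : ∀ g, latHom g (latHom h r) = latHom h r ↔ h⁻¹ * g * h ∈ f.range := by
    intro g
    rw [← hr, map_mul, map_mul, LinearEquiv.mul_apply, LinearEquiv.mul_apply, map_inv]
    exact (LinearEquiv.symm_apply_eq (latHom h)).symm
  let F : H →* LatAut := latHom.comp ((MulAut.conj h).toMonoidHom.comp f)
  have hF : F.range = stab quinticGroup (latHom h r) := by
    ext A
    constructor
    · rintro ⟨y, rfl⟩
      refine ⟨⟨_, rfl⟩, (hmem _).2 ⟨y, ?_⟩⟩
      simp [mul_assoc]
    · rintro ⟨⟨g, rfl⟩, hg⟩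
      obtain ⟨y, hy⟩ := (hmem g).1 hg
      exact ⟨y, by simp [F, hy, mul_assoc]⟩
  have hFinj : Function.Injective F := latHom_injective.comp ((MulAut.conj h).injective.comp hf)
  exact ⟨((MonoidHom.ofInjective hFinj).trans (MulEquiv.subgroupCongr hF)).symm⟩

theorem latHom_excDiv_seven (g : Perm (Fin 5)) :
    latHom g (excDiv 7) = excDiv 7 ↔ g ∈ (alternatingGroup (Fin 5)).subtype.range := by
  have h : ∀ s : ℤˣ, signAut s (excDiv 7) = excDiv 7 ↔ s = 1 := by decide +kernel
  rw [latHom_apply, permAut_excDiv, sylowHom_seven, h, Subgroup.range_subtype,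
    Perm.mem_alternatingGroup]

/-- The dihedral group of order ten as the stabilizer of the first Sylow subgroup in `A₅`. -/
def dihedralHom : DihedralGroup 5 →* Perm (Fin 5) where
  toFun
    | .r k => rot ^ k.val
    | .sr k => swap 1 4 * swap 2 3 * rot ^ k.val
  map_one' := by decide +kernel
  map_mul' := by decide +kernel

theorem dihedralHom_injective : Function.Injective dihedralHom := by decide +kernel

theorem latHom_excDiv_one (g : Perm (Fin 5)) :
    latHom g (excDiv 1) = excDiv 1 ↔ g ∈ dihedralHom.range := by
  have hrange : ∀ g, Perm.sign g = 1 ∧ Conjugates g 1 1 ↔ ∃ d, dihedralHom d = g := by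
    decide +kernel
  have h : ∀ s : ℤˣ, ∀ i ∈ middle, signAut s (excDiv i) = excDiv 1 ↔ s = 1 ∧ i = 1 := by
    decide +kernel
  rw [MonoidHom.mem_range, ← hrange, latHom_apply, permAut_excDiv,
    h _ _ (sylowHom_mem_middle g (by decide)), sylowHom_apply_eq_iff]

theorem latHom_neg_Kvec_sub_excDiv_one (g : Perm (Fin 5)) :
    latHom g (-Kvec - excDiv 1) = -Kvec - excDiv 1 ↔ g ∈ dihedralHom.range := by
  rw [map_sub, map_neg, latHom_Kvec, sub_right_inj, latHom_excDiv_one]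

/-- The Klein four-group as the stabilizer of a pair of Sylow subgroups in `A₅`. -/
def kleinHom : Multiplicative (ZMod 2) × Multiplicative (ZMod 2) →* Perm (Fin 5) where
  toFun p := (swap 0 2 * swap 3 4) ^ p.1.toAdd.val * (swap 0 3 * swap 2 4) ^ p.2.toAdd.val
  map_one' := by decide +kernel
  map_mul' := by decide +kernel

theorem kleinHom_injective : Function.Injective kleinHom := by decide +kernel

theorem latHom_chord_one_two (g : Perm (Fin 5)) :
    latHom g (chord 1 2) = chord 1 2 ↔ g ∈ kleinHom.range := by
  have hrange : ∀ g, (Perm.sign g = 1 ∧ (Conjugates g 1 1 ∧ Conjugates g 2 2 ∨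
      Conjugates g 1 2 ∧ Conjugates g 2 1)) ↔ ∃ d, kleinHom d = g := by
    decide +kernel
  have h : ∀ s : ℤˣ, ∀ i ∈ middle, ∀ j ∈ middle, i ≠ j →
      (signAut s (chord i j) = chord 1 2 ↔ s = 1 ∧ (i = 1 ∧ j = 2 ∨ i = 2 ∧ j = 1)) := by
    decide +kernel
  rw [MonoidHom.mem_range, ← hrange, latHom_apply, permAut_chord (sylowHom_zero g),
    h _ _ (sylowHom_mem_middle g (by decide)) _ (sylowHom_mem_middle g (by decide))
      ((sylowHom g).injective.ne (by decide))]
  simp only [sylowHom_apply_eq_iff]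

theorem nonempty_stab_mulEquiv_of_ncard {x : V} (hx : x ∈ Exc) :
    ((orb quinticGroup x).ncard = 2 →
      Nonempty (stab quinticGroup x ≃* alternatingGroup (Fin 5))) ∧
    ((orb quinticGroup x).ncard = 12 → Nonempty (stab quinticGroup x ≃* DihedralGroup 5)) ∧
    ((orb quinticGroup x).ncard = 30 →
      Nonempty (stab quinticGroup x ≃* (Multiplicative (ZMod 2) × Multiplicative (ZMod 2)))) := by
  obtain ⟨k, hk⟩ := exists_mem_orb hx
  rw [orb_eq_of_mem hk, ncard_orb_orbitRep]
  fin_cases k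
  · exact ⟨fun _ => nonempty_stab_mulEquiv _ (Subgroup.subtype_injective _) latHom_excDiv_seven hk,
      by simp [orbitLength], by simp [orbitLength]⟩
  · exact ⟨by simp [orbitLength], fun _ =>
      nonempty_stab_mulEquiv _ dihedralHom_injective latHom_excDiv_one hk, by simp [orbitLength]⟩
  · exact ⟨by simp [orbitLength], fun _ =>
      nonempty_stab_mulEquiv _ dihedralHom_injective latHom_neg_Kvec_sub_excDiv_one hk,
      by simp [orbitLength]⟩
  · exact ⟨by simp [orbitLength], by simp [orbitLength], fun _ =>
      nonempty_stab_mulEquiv _ kleinHom_injective latHom_chord_one_two hk⟩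

/-! ### Condition (H1) -/

/-- One of the two orbits of ten triples of Sylow subgroups under `A₅`. -/
def triples : Finset (Fin 8 × Fin 8 × Fin 8) :=
  {(1, 2, 5), (1, 2, 6), (1, 3, 4), (1, 3, 6), (1, 4, 5), (2, 3, 4), (2, 3, 5), (2, 4, 6),
    (3, 5, 6), (4, 5, 6)}

/-- Pairs of a functional (through the intersection form) and a vector whose sum is the identity
of the lattice, permuted by the action. -/
def factorSet : Finset (V × V) :=
  (orbitFinset 1).image (fun e => (e, e)) ∪
  triples.image (fun t => (chord t.1 t.2.1 - excDiv t.2.2, -(chord t.1 t.2.1 - excDiv t.2.2))) ∪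
  (orbitFinset 0).image (fun e => (e, -e)) ∪
  {(Cvec, 2 • Kvec - Cvec), (Kvec, 2 • Cvec + 3 • Kvec)}

theorem sum_factorSet (x : V) : ∑ p ∈ factorSet, bil p.1 x • p.2 = x := by
  have hbasis : ∀ i : Fin 8,
      ∑ p ∈ factorSet, bil p.1 (Pi.single i 1) • p.2 = Pi.single i 1 := by
    decide +kernel
  have hlin : ∑ p ∈ factorSet, (bilLeft p.1).smulRight p.2 = LinearMap.id :=
    LinearMap.pi_ext' fun i => LinearMap.ext_ring (by
      simpa [LinearMap.sum_apply, bilLeft] using hbasis i)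
  simpa [LinearMap.sum_apply, bilLeft] using LinearMap.congr_fun hlin x

theorem image_factorSet (g : Perm (Fin 5)) :
    factorSet.image (Prod.map (latHom g) (latHom g)) = factorSet := by
  induction g using generator_induction with
  | hr =>
    have h : Perm.sign rot = 1 := by decide +kernel
    rw [latHom_def, sylowHom_rot, h]
    decide +kernel
  | ht =>
    have h : Perm.sign transp = -1 := by decide +kernel
    rw [latHom_def, sylowHom_transp, h]
    decide +kernel
  | h1 =>
    rw [map_one]
    exact Finset.image_id
  | hm g h hg hh =>
    conv_rhs => rw [← hg, ← hh, Finset.image_image]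
    rw [map_mul]
    rfl
  | hi g hg =>
    conv_lhs => rw [← hg, Finset.image_image]
    have h : Prod.map (latHom g⁻¹) (latHom g⁻¹) ∘ Prod.map (latHom g) (latHom g) = id := by
      funext p
      rw [map_inv]
      exact Prod.ext ((latHom g).symm_apply_apply p.1) ((latHom g).symm_apply_apply p.2)
    rw [h, Finset.image_id]

theorem condH1_quinticGroup : CondH1 quinticGroup := by
  intro G' hG'
  have : Finite G' := Finite.of_injective _ (Subgroup.inclusion_injective hG')
  refine subsingleton_H1_of_factorization G' (hG'.trans quinticGroup_le_W) factorSet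
    (fun A hA => ?_) sum_factorSet
  obtain ⟨g, rfl⟩ := hG' hA
  exact image_factorSet g

theorem exists_dp2_S5_conic :
    ∃ G : Subgroup LatAut, G ≤ W ∧
      Nonempty (G ≃* Equiv.Perm (Fin 5)) ∧
      (orbs G).ncard = 4 ∧
      {S ∈ orbs G | S.ncard = 2}.ncard = 1 ∧
      {S ∈ orbs G | S.ncard = 12}.ncard = 2 ∧
      {S ∈ orbs G | S.ncard = 30}.ncard = 1 ∧
      (∀ E ∈ Exc,
        ((orb G E).ncard = 2 → Nonempty (stab G E ≃* alternatingGroup (Fin 5))) ∧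
        ((orb G E).ncard = 12 → Nonempty (stab G E ≃* DihedralGroup 5)) ∧
        ((orb G E).ncard = 30 →
          Nonempty (stab G E ≃* (Multiplicative (ZMod 2) × Multiplicative (ZMod 2))))) ∧
      MinimalAction G ∧
      (∃ C, IsConic C ∧ ∀ g ∈ G, g C = C) ∧
      CondH1 G := by
  refine ⟨quinticGroup, quinticGroup_le_W, ⟨(MonoidHom.ofInjective latHom_injective).symm⟩, ?_,
    (ncard_orbs_of_length 2).trans (by decide), (ncard_orbs_of_length 12).trans (by decide),
    (ncard_orbs_of_length 30).trans (by decide), fun _ => nonempty_stab_mulEquiv_of_ncard,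
    minimalAction_quinticGroup, ⟨Cvec, by constructor <;> decide +kernel, ?_⟩,
    condH1_quinticGroup⟩
  · rw [orbs_quinticGroup, ← Set.image_univ,
      Set.ncard_image_of_injective _ orb_orbitRep_injective, Set.ncard_univ, Nat.card_fin]
  · rintro _ ⟨g, rfl⟩
    exact latHom_Cvec g

end
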